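/- Let a be a smooth 1-form on a neighborhood of 0 ∈ ℝ² with a(0) = 0 (a is singular at the origin), let X_a be its corresponding vector field, and let f be a smooth function with f(0,0) = 0. Write Lf(p) = df(p)(X_a(p)) for the Lie derivative of f along X_a. Assume f has finite codimension k: there exist smooth functions e₁, …, e_k near 0 such that every smooth function F near 0 can be written F = Σ_{i=1}^k cᵢ·eᵢ + u·f + v·Lf near 0 with constants cᵢ ∈ ℝ and smooth u, v, and the constants c₁, …, c_k are uniquely determined by the germ of F. Then f is K_a-equivalent to its k-jet: there exist a local diffeomorphism φ at 0 with φ(0) = 0 and smooth nonvanishing functions κ, λ near 0 such that a = κ·φ*(a) and f = λ·((j^k f) ∘ φ) near the origin, where j^k f is the Taylor polynomial of f at 0 of degree k. -/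

import Mathlib

noncomputable section

/-- The standard area form of the plane: ω(u,v) = u₁v₂ − u₂v₁. -/
def omegaForm (u v : ℝ × ℝ) : ℝ := u.1 * v.2 - u.2 * v.1

/-- The degree-`k` Taylor polynomial (the `k`-jet) of `f : ℝ² → ℝ` at the origin. -/
def jet (k : ℕ) (f : ℝ × ℝ → ℝ) : ℝ × ℝ → ℝ :=
  fun p => ∑ i ∈ Finset.range (k + 1),
    ((i.factorial : ℝ))⁻¹ * iteratedFDeriv ℝ i f 0 (fun _ => p)

section Preliminaries

open Set Filter Topology
open scoped ContDiff

namespace PathSpace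

variable {E F : Type} [NormedAddCommGroup E] [NormedAddCommGroup F]

/-- The superposition operator `γ ↦ (t ↦ V (t, γ t))` on continuous paths. -/
def superpose (V : ℝ × E → F) (hV : Continuous V) (γ : C(Icc (0 : ℝ) 1, E)) :
    C(Icc (0 : ℝ) 1, F) :=
  ⟨fun t => V (t, γ t), by fun_prop⟩

theorem continuous_superpose (V : ℝ × E → F) (hV : Continuous V) :
    Continuous (superpose V hV) := by
  apply ContinuousMap.continuous_of_continuous_uncurry
  change Continuous fun p : C(Icc (0 : ℝ) 1, E) × Icc (0 : ℝ) 1 => V (p.2, p.1 p.2)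
  fun_prop

variable [NormedSpace ℝ E] [NormedSpace ℝ F]

/-- Pointwise application of a path of continuous linear maps to a path. -/
def applyPath : C(Icc (0 : ℝ) 1, E →L[ℝ] F) →L[ℝ] C(Icc (0 : ℝ) 1, E) →L[ℝ] C(Icc (0 : ℝ) 1, F) :=
  LinearMap.mkContinuous₂
    (LinearMap.mk₂ ℝ (fun (A : C(Icc (0 : ℝ) 1, E →L[ℝ] F)) (δ : C(Icc (0 : ℝ) 1, E)) =>
        (⟨fun t => A t (δ t), by fun_prop⟩ : C(Icc (0 : ℝ) 1, F)))
      (by intros; ext; simp) (by intros; ext; simp) (by intros; ext; simp)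
      (by intros; ext; simp)) 1 (by
    intro A δ
    rw [ContinuousMap.norm_le _ (by positivity)]
    intro t
    have h1 := A.norm_coe_le_norm t
    have h2 := δ.norm_coe_le_norm t
    calc ‖A t (δ t)‖ ≤ ‖A t‖ * ‖δ t‖ := (A t).le_opNorm _
      _ ≤ 1 * ‖A‖ * ‖δ‖ := by rw [one_mul]; gcongr)

@[simp]
theorem applyPath_apply (A : C(Icc (0 : ℝ) 1, E →L[ℝ] F)) (δ : C(Icc (0 : ℝ) 1, E))
    (t : Icc (0 : ℝ) 1) : applyPath A δ t = A t (δ t) := rfl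

/-- The partial derivative of `V` in the space variable. -/
def spaceDeriv (V : ℝ × E → F) (p : ℝ × E) : E →L[ℝ] F :=
  (fderiv ℝ V p).comp (ContinuousLinearMap.inr ℝ ℝ E)

theorem contDiff_spaceDeriv {V : ℝ × E → F} {n m : WithTop ℕ∞} (hV : ContDiff ℝ n V)
    (hmn : m + 1 ≤ n) : ContDiff ℝ m (spaceDeriv V) :=
  (hV.fderiv_right hmn).clm_comp contDiff_const

theorem hasFDerivAt_space {V : ℝ × E → F} (hV : Differentiable ℝ V) (t : ℝ) (x : E) :
    HasFDerivAt (fun x => V (t, x)) (spaceDeriv V (t, x)) x :=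
  (hV (t, x)).hasFDerivAt.comp x (hasFDerivAt_prodMk_right t x)

theorem hasFDerivAt_superpose {V : ℝ × E → F} (hV : ContDiff ℝ 1 V)
    (γ : C(Icc (0 : ℝ) 1, E)) :
    HasFDerivAt (superpose V hV.continuous)
      (applyPath (superpose (spaceDeriv V)
        (contDiff_spaceDeriv (m := 0) hV (by simp)).continuous γ)) γ := by
  have hc := (contDiff_spaceDeriv (m := 0) hV (by simp)).continuous
  rw [hasFDerivAt_iff_isLittleO_nhds_zero, Asymptotics.isLittleO_iff]
  intro ε hε
  let K : E → C(Icc (0 : ℝ) 1, E →L[ℝ] F) := fun d =>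
    ⟨fun t => spaceDeriv V (t, γ t + d), by fun_prop⟩
  have hK : Continuous K := by
    apply ContinuousMap.continuous_of_continuous_uncurry
    change Continuous fun p : E × Icc (0 : ℝ) 1 => spaceDeriv V (p.2, γ p.2 + p.1)
    fun_prop
  obtain ⟨r, hr, hball⟩ := Metric.mem_nhds_iff.1
    (hK.continuousAt.preimage_mem_nhds (Metric.ball_mem_nhds (K 0) hε))
  filter_upwards [Metric.ball_mem_nhds (0 : C(Icc (0 : ℝ) 1, E)) hr] with δ hδ
  rw [mem_ball_zero_iff] at hδ
  rw [ContinuousMap.norm_le _ (by positivity)]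
  intro t
  have hδt := δ.norm_coe_le_norm t
  have key := (convex_ball (γ t) r).norm_image_sub_le_of_norm_hasFDerivWithin_le'
    (f := fun x => V (t, x)) (f' := fun x => spaceDeriv V (t, x))
    (φ := spaceDeriv V (t, γ t)) (C := ε) (x := γ t) (y := γ t + δ t)
    (fun x _ => (hasFDerivAt_space (hV.differentiable (by simp)) t x).hasFDerivWithinAt)
    (fun x hx => by
      have h1 : x - γ t ∈ Metric.ball (0 : E) r := by simpa [dist_eq_norm] using hx
      have h2 := ((K (x - γ t) - K 0).norm_coe_le_norm t).trans
        (mem_ball_iff_norm.1 (hball h1)).le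
      simpa [K] using h2)
    (Metric.mem_ball_self hr) (by simpa [Metric.mem_ball, dist_eq_norm] using hδt.trans_lt hδ)
  calc _ ≤ ε * ‖γ t + δ t - γ t‖ := by simpa [superpose] using key
    _ ≤ ε * ‖δ‖ := by rw [add_sub_cancel_left]; gcongr

theorem contDiff_superpose_nat (n : ℕ) : ∀ {F : Type} [NormedAddCommGroup F] [NormedSpace ℝ F]
    {V : ℝ × E → F} (hV : ContDiff ℝ n V), ContDiff ℝ n (superpose V hV.continuous) := by
  induction n with
  | zero =>
    intro F _ _ V hV
    exact contDiff_zero.2 (continuous_superpose V hV.continuous)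
  | succ n ih =>
    intro F _ _ V hV
    have h1 : ContDiff ℝ 1 V := hV.of_le (by norm_cast; omega)
    have h2 : ContDiff ℝ n (spaceDeriv V) := contDiff_spaceDeriv hV (by norm_cast)
    push_cast
    rw [contDiff_succ_iff_hasFDerivAt]
    refine ⟨fun γ => applyPath (superpose (spaceDeriv V) h2.continuous γ), ?_,
      fun γ => hasFDerivAt_superpose h1 γ⟩
    exact ContDiff.comp (g := applyPath) (ContinuousLinearMap.contDiff _) (ih h2)

theorem contDiff_superpose {V : ℝ × E → F} (hV : ContDiff ℝ ∞ V) :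
    ContDiff ℝ ∞ (superpose V hV.continuous) :=
  contDiff_infty.2 fun n => contDiff_superpose_nat n (hV.of_le (by exact_mod_cast le_top))

/-- The indefinite integral, as an operator on continuous paths. -/
def primitive : C(Icc (0 : ℝ) 1, F) →L[ℝ] C(Icc (0 : ℝ) 1, F) :=
  LinearMap.mkContinuous
    { toFun := fun A => ⟨fun t => ∫ s in (0 : ℝ)..t, IccExtend zero_le_one A s, by
        have : Continuous fun t : ℝ => ∫ s in (0 : ℝ)..t, IccExtend zero_le_one A s :=
          intervalIntegral.continuous_primitive
            (fun a b => (A.continuous.Icc_extend').intervalIntegrable a b) 0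
        fun_prop⟩
      map_add' := fun A B => by
        ext t
        exact intervalIntegral.integral_add (A.continuous.Icc_extend'.intervalIntegrable _ _)
          (B.continuous.Icc_extend'.intervalIntegrable _ _)
      map_smul' := fun c A => by
        ext t
        exact intervalIntegral.integral_smul c _ } 1 (by
    intro A
    rw [ContinuousMap.norm_le _ (by positivity)]
    intro t
    have := intervalIntegral.norm_integral_le_of_norm_le_const (a := 0) (b := t)
      (f := IccExtend zero_le_one A) (C := ‖A‖) (fun s _ => A.norm_coe_le_norm _)
    refine this.trans ?_
    have h1 : |(t : ℝ) - 0| ≤ 1 := by rw [sub_zero, abs_of_nonneg t.2.1]; exact t.2.2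
    nlinarith [norm_nonneg A])

theorem primitive_apply (A : C(Icc (0 : ℝ) 1, F)) (t : Icc (0 : ℝ) 1) :
    primitive A t = ∫ s in (0 : ℝ)..t, IccExtend zero_le_one A s := rfl

theorem hasDerivAt_integral_path [CompleteSpace F] (A : C(Icc (0 : ℝ) 1, F)) (t : ℝ) :
    HasDerivAt (fun t : ℝ => ∫ s in (0 : ℝ)..t, IccExtend zero_le_one A s)
      (IccExtend zero_le_one A t) t :=
  intervalIntegral.integral_hasDerivAt_right (A.continuous.Icc_extend'.intervalIntegrable _ _)
    (A.continuous.Icc_extend'.stronglyMeasurableAtFilter _ _) A.continuous.Icc_extend'.continuousAt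

/-- The total integral of a path. -/
def total : C(Icc (0 : ℝ) 1, F) →L[ℝ] F :=
  (ContinuousMap.evalCLM ℝ (1 : Icc (0 : ℝ) 1)).comp primitive

/-- Constant paths. -/
def constPath : E →L[ℝ] C(Icc (0 : ℝ) 1, E) :=
  LinearMap.mkContinuous
    { toFun := fun x => ContinuousMap.const _ x
      map_add' := fun _ _ => rfl
      map_smul' := fun _ _ => rfl } 1 (by
    intro x
    rw [ContinuousMap.norm_le _ (by positivity)]
    intro t
    rw [one_mul]
    exact le_rfl)

@[simp]
theorem constPath_apply (x : E) (t : Icc (0 : ℝ) 1) : constPath x t = x := rfl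

theorem contDiff_primitive {n : WithTop ℕ∞} :
    ContDiff ℝ n (primitive : C(Icc (0 : ℝ) 1, F) → C(Icc (0 : ℝ) 1, F)) :=
  ContinuousLinearMap.contDiff _

theorem contDiff_total {n : WithTop ℕ∞} : ContDiff ℝ n (total : C(Icc (0 : ℝ) 1, F) → F) :=
  ContinuousLinearMap.contDiff _

theorem contDiff_constPath {n : WithTop ℕ∞} :
    ContDiff ℝ n (constPath : E → C(Icc (0 : ℝ) 1, E)) :=
  ContinuousLinearMap.contDiff _

theorem hasFDerivAt_primitive (A : C(Icc (0 : ℝ) 1, F)) : HasFDerivAt primitive primitive A :=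
  ContinuousLinearMap.hasFDerivAt _

theorem hasFDerivAt_constPath (x : E) :
    HasFDerivAt (constPath : E → C(Icc (0 : ℝ) 1, E)) constPath x :=
  ContinuousLinearMap.hasFDerivAt _

/-- Evaluation of paths at a time. -/
def evalPath (t : Icc (0 : ℝ) 1) : C(Icc (0 : ℝ) 1, E) →L[ℝ] E := ContinuousMap.evalCLM ℝ t

theorem contDiff_evalPath (t : Icc (0 : ℝ) 1) {n : WithTop ℕ∞} :
    ContDiff ℝ n (evalPath t : C(Icc (0 : ℝ) 1, E) → E) :=
  ContinuousLinearMap.contDiff _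

theorem hasFDerivAt_evalPath (t : Icc (0 : ℝ) 1) (γ : C(Icc (0 : ℝ) 1, E)) :
    HasFDerivAt (evalPath t : C(Icc (0 : ℝ) 1, E) → E) (evalPath t) γ :=
  ContinuousLinearMap.hasFDerivAt _

end PathSpace

namespace PathSpace

variable {E : Type} [NormedAddCommGroup E] [NormedSpace ℝ E]

/-- The map `γ ↦ γ - ∫ V (s, γ s) ds`, whose value is the constant path `x` exactly when `γ` solves
`γ' = V (t, γ)` with `γ 0 = x`. -/
def defect (V : ℝ × E → E) (hV : Continuous V) (γ : C(Icc (0 : ℝ) 1, E)) : C(Icc (0 : ℝ) 1, E) :=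
  γ - primitive (superpose V hV γ)

theorem contDiff_defect {V : ℝ × E → E} (hV : ContDiff ℝ ∞ V) :
    ContDiff ℝ ∞ (defect V hV.continuous) :=
  contDiff_id.sub (contDiff_primitive.comp (contDiff_superpose hV))

theorem hasFDerivAt_defect {V : ℝ × E → E} (hV : ContDiff ℝ ∞ V) (γ : C(Icc (0 : ℝ) 1, E)) :
    HasFDerivAt (defect V hV.continuous) (ContinuousLinearMap.id ℝ _ - primitive.comp
      (applyPath (superpose (spaceDeriv V)
        (contDiff_spaceDeriv (m := 0) hV (by simp)).continuous γ))) γ :=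
  (hasFDerivAt_id γ).sub
    ((hasFDerivAt_primitive _).comp γ (hasFDerivAt_superpose (hV.of_le (by simp)) γ))

variable [CompleteSpace E]

/-- Smooth dependence on initial conditions near an equilibrium where the field vanishes to
second order. -/
theorem exists_smooth_flow {V : ℝ × E → E} (hV : ContDiff ℝ ∞ V) (h0 : ∀ t, V (t, 0) = 0)
    (h1 : ∀ t, spaceDeriv V (t, 0) = 0) :
    ∃ (Γ : E → C(Icc (0 : ℝ) 1, E)) (W : Set E), IsOpen W ∧ (0 : E) ∈ W ∧
      ContDiffOn ℝ ∞ Γ W ∧ Γ 0 = 0 ∧ fderiv ℝ Γ 0 = constPath ∧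
      ∀ x ∈ W, defect V hV.continuous (Γ x) = constPath x := by
  set G := defect V hV.continuous with hG
  have hGs : ContDiff ℝ ∞ G := contDiff_defect hV
  have hG0 : G 0 = 0 := by
    have : superpose V hV.continuous 0 = 0 := by ext t; exact h0 t
    simp [hG, defect, this]
  have hGd : HasFDerivAt G
      ((ContinuousLinearEquiv.refl ℝ C(Icc (0 : ℝ) 1, E) : _ ≃L[ℝ] _) : _ →L[ℝ] _) 0 := by
    convert hasFDerivAt_defect hV 0 using 1
    have : superpose (spaceDeriv V)
        (contDiff_spaceDeriv (m := 0) hV (by simp)).continuous 0 = 0 := by ext1 t; exact h1 t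
    rw [this]
    simp
  let H := hGs.contDiffAt.toOpenPartialHomeomorph G hGd (by simp)
  have hHG : ∀ γ, H γ = G γ := fun _ => rfl
  have h0s : (0 : C(Icc (0 : ℝ) 1, E)) ∈ H.source :=
    hGs.contDiffAt.mem_toOpenPartialHomeomorph_source hGd (by simp)
  have h0t : (0 : C(Icc (0 : ℝ) 1, E)) ∈ H.target := by
    have := H.map_source h0s
    rwa [hHG, hG0] at this
  have hs0 : H.symm 0 = 0 := by
    have := H.left_inv h0s
    rwa [hHG, hG0] at this
  have hev : ∀ᶠ γ in 𝓝 (0 : C(Icc (0 : ℝ) 1, E)), fderiv ℝ G γ ∈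
      range ((↑) : (C(Icc (0 : ℝ) 1, E) ≃L[ℝ] C(Icc (0 : ℝ) 1, E)) → _ →L[ℝ] _) := by
    refine (hGs.continuous_fderiv (by simp)).continuousAt.preimage_mem_nhds ?_
    rw [hGd.fderiv]
    exact ContinuousLinearEquiv.nhds _
  obtain ⟨S, hSsub, hSo, hS0⟩ := mem_nhds_iff.1 hev
  have hT : IsOpen (H.target ∩ H.symm ⁻¹' S) := H.isOpen_inter_preimage_symm hSo
  refine ⟨fun x => H.symm (constPath x), constPath ⁻¹' (H.target ∩ H.symm ⁻¹' S),
    hT.preimage constPath.continuous, ⟨by simpa using h0t, by simpa [hs0] using hS0⟩, ?_, ?_, ?_,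
    ?_⟩
  · intro x hx
    obtain ⟨A, hA⟩ := hSsub hx.2
    have : ContDiffAt ℝ ∞ H.symm (constPath x) := by
      refine H.contDiffAt_symm (f₀' := A) hx.1 ?_ hGs.contDiffAt
      rw [hA]
      exact (hGs.differentiable (by simp) _).hasFDerivAt
    exact (this.comp x contDiff_constPath.contDiffAt).contDiffWithinAt
  · simpa using hs0
  · have hd : HasFDerivAt H.symm
        ((ContinuousLinearEquiv.refl ℝ C(Icc (0 : ℝ) 1, E) : _ ≃L[ℝ] _) : _ →L[ℝ] _)
        (constPath (0 : E)) := by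
      have := H.hasFDerivAt_symm (f' := ContinuousLinearEquiv.refl ℝ C(Icc (0 : ℝ) 1, E)) h0t
        (by rw [hs0]; exact hGd)
      rw [map_zero]
      exact this
    exact (hd.comp (0 : E) (hasFDerivAt_constPath 0)).fderiv
  · intro x hx
    exact H.right_inv hx.1

/-- The solution path extended to all times by integrating the field along it. -/
theorem hasDerivAt_of_eq_add_primitive {γ B : C(Icc (0 : ℝ) 1, E)} {x : E}
    (h : γ - primitive B = constPath x) :
    ∃ g : ℝ → E, g 0 = x ∧ (∀ t : Icc (0 : ℝ) 1, g t = γ t) ∧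
      ∀ t : Icc (0 : ℝ) 1, HasDerivAt g (B t) t := by
  refine ⟨fun t => x + ∫ s in (0 : ℝ)..t, IccExtend zero_le_one B s, by simp, fun t => ?_,
    fun t => ?_⟩
  · have := DFunLike.congr_fun h t
    rw [ContinuousMap.sub_apply, constPath_apply, primitive_apply, sub_eq_iff_eq_add] at this
    exact this.symm
  · have := (hasDerivAt_integral_path B t).const_add x
    rwa [IccExtend_val] at this

/-- A scalar linear homogeneous equation `y' = c y` on `[0, 1]`. -/
theorem eq_exp_total_mul {c : C(Icc (0 : ℝ) 1, ℝ)} {y : ℝ → ℝ}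
    (hy : ∀ t : Icc (0 : ℝ) 1, HasDerivAt y (c t * y t) t) :
    y 1 = Real.exp (total c) * y 0 := by
  let P : ℝ → ℝ := fun t => ∫ s in (0 : ℝ)..t, IccExtend zero_le_one c s
  have hz : ∀ t ∈ Icc (0 : ℝ) 1, HasDerivAt (fun t => y t * Real.exp (-P t)) 0 t := by
    intro t ht
    have h := (hy ⟨t, ht⟩).mul (hasDerivAt_integral_path c t).neg.exp
    rw [IccExtend_of_mem _ _ ht] at h
    refine h.congr_deriv ?_
    ring
  have key := constant_of_has_deriv_right_zero (f := fun t => y t * Real.exp (-P t)) (a := 0)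
    (b := 1) (fun t ht => (hz t ht).continuousAt.continuousWithinAt)
    (fun t ht => (hz t (Ico_subset_Icc_self ht)).hasDerivWithinAt) 1 (by simp)
  have hP1 : P 1 = total c := rfl
  have hP0 : P 0 = 0 := by simp [P]
  simp only [hP1, hP0, neg_zero, Real.exp_zero, mul_one] at key
  rw [← key, mul_left_comm, ← Real.exp_add]
  simp

end PathSpace

namespace PathSpace

/-- The divergence of a planar vector field. -/
def planarDiv (X : ℝ × ℝ → ℝ × ℝ) (x : ℝ × ℝ) : ℝ :=
  (fderiv ℝ X x (1, 0)).1 + (fderiv ℝ X x (0, 1)).2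

theorem contDiff_planarDiv {X : ℝ × ℝ → ℝ × ℝ} (hX : ContDiff ℝ ∞ X) :
    ContDiff ℝ ∞ (planarDiv X) := by
  have h := hX.fderiv_right (m := ∞) (by simp)
  exact (h.clm_apply contDiff_const).fst.add (h.clm_apply contDiff_const).snd

theorem planarDiv_mul_omegaForm (L : ℝ × ℝ →L[ℝ] ℝ × ℝ) (x w : ℝ × ℝ) :
    omegaForm (L x) w + omegaForm x (L w) = ((L (1, 0)).1 + (L (0, 1)).2) * omegaForm x w := by
  have h : ∀ z : ℝ × ℝ, L z = z.1 • L (1, 0) + z.2 • L (0, 1) := by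
    intro z
    rw [← map_smul, ← map_smul, ← map_add]
    simp
  rw [h x, h w]
  simp only [omegaForm, Prod.fst_add, Prod.snd_add, Prod.smul_fst, Prod.smul_snd, smul_eq_mul]
  ring

theorem hasDerivAt_omegaForm {p q : ℝ → ℝ × ℝ} {p' q' : ℝ × ℝ} {t : ℝ} (hp : HasDerivAt p p' t)
    (hq : HasDerivAt q q' t) :
    HasDerivAt (fun s => omegaForm (p s) (q s)) (omegaForm p' (q t) + omegaForm (p t) q') t := by
  have hp₁ : HasDerivAt (fun s => (p s).1) p'.1 t :=
    (hasFDerivAt_fst (p := p t)).comp_hasDerivAt t hp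
  have hp₂ : HasDerivAt (fun s => (p s).2) p'.2 t :=
    (hasFDerivAt_snd (p := p t)).comp_hasDerivAt t hp
  have hq₁ : HasDerivAt (fun s => (q s).1) q'.1 t :=
    (hasFDerivAt_fst (p := q t)).comp_hasDerivAt t hq
  have hq₂ : HasDerivAt (fun s => (q s).2) q'.2 t :=
    (hasFDerivAt_snd (p := q t)).comp_hasDerivAt t hq
  refine ((hp₁.mul hq₂).sub (hp₂.mul hq₁)).congr_deriv ?_
  simp only [omegaForm]
  ring

theorem spaceDeriv_smul {v : ℝ × (ℝ × ℝ) → ℝ} {X : ℝ × ℝ → ℝ × ℝ} (hv : ContDiff ℝ ∞ v)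
    (hX : ContDiff ℝ ∞ X) (p : ℝ × (ℝ × ℝ)) (w : ℝ × ℝ) :
    spaceDeriv (fun p => -v p • X p.2) p w =
      -v p • fderiv ℝ X p.2 w - fderiv ℝ v p (0, w) • X p.2 := by
  have hX' : HasFDerivAt (fun p : ℝ × (ℝ × ℝ) => X p.2)
      ((fderiv ℝ X p.2).comp (ContinuousLinearMap.snd ℝ ℝ (ℝ × ℝ))) p :=
    ((hX.differentiable (by simp) p.2).hasFDerivAt).comp p hasFDerivAt_snd
  have h := ((hv.differentiable (by simp) p).hasFDerivAt.neg).smul hX'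
  simp only [spaceDeriv]
  erw [h.fderiv]
  simp [sub_eq_add_neg]

variable {X : ℝ × ℝ → ℝ × ℝ} {v : ℝ × (ℝ × ℝ) → ℝ}

/-- Along the flow of a multiple of `X`, the form `ω(X, ·)` is multiplied by a function. -/
theorem omegaForm_transport (hX : ContDiff ℝ ∞ X) (hv : ContDiff ℝ ∞ v)
    (hV : ContDiff ℝ ∞ fun p : ℝ × (ℝ × ℝ) => -v p • X p.2)
    (hc : Continuous fun p : ℝ × (ℝ × ℝ) => -v p * planarDiv X p.2)
    {γ δ : C(Icc (0 : ℝ) 1, ℝ × ℝ)} {x w : ℝ × ℝ}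
    (hγ : γ - primitive (superpose _ hV.continuous γ) = constPath x)
    (hδ : δ - primitive (applyPath (superpose _
      (contDiff_spaceDeriv (m := 0) hV (by simp)).continuous γ) δ) = constPath w) :
    omegaForm (X (γ 1)) (δ 1) = Real.exp (total (superpose _ hc γ)) * omegaForm (X x) w := by
  obtain ⟨g, hg0, hgγ, hg⟩ := hasDerivAt_of_eq_add_primitive hγ
  obtain ⟨d, hd0, hdδ, hd⟩ := hasDerivAt_of_eq_add_primitive hδ
  have key := eq_exp_total_mul (c := superpose _ hc γ) (y := fun t => omegaForm (X (g t)) (d t))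
    (by
      intro t
      have h1 := ((hX.differentiable (by simp) (g t)).hasFDerivAt).comp_hasDerivAt (t : ℝ) (hg t)
      have h2 := hasDerivAt_omegaForm h1 (hd t)
      refine h2.congr_deriv ?_
      have e1 : (applyPath (superpose _ (contDiff_spaceDeriv (m := 0) hV (by simp)).continuous γ)
          δ) t = spaceDeriv (fun p => -v p • X p.2) (t, γ t) (δ t) := rfl
      have e2 : superpose _ hV.continuous γ t = -v (t, γ t) • X (γ t) := rfl
      have e3 : superpose _ hc γ t = -v (t, γ t) * planarDiv X (γ t) := rfl
      have := planarDiv_mul_omegaForm (fderiv ℝ X (γ t)) (X (γ t)) (δ t)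
      rw [e1, e2, e3, spaceDeriv_smul hv hX, Function.comp_apply, hgγ, hdδ, planarDiv, mul_assoc,
        ← this, map_smul]
      simp only [omegaForm, Prod.smul_fst, Prod.smul_snd, smul_eq_mul, Prod.fst_sub, Prod.snd_sub]
      ring)
  have h1 := hgγ 1
  have h2 := hdδ 1
  simp only [Icc.coe_one] at h1 h2
  simpa [h1, h2, hg0, hd0] using key

theorem function_transport {F h : ℝ × ℝ → ℝ} {u : ℝ × (ℝ × ℝ) → ℝ} (hF : ContDiff ℝ ∞ F)
    (hh : ContDiff ℝ ∞ h) (hu : Continuous u)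
    (hV : ContDiff ℝ ∞ fun p : ℝ × (ℝ × ℝ) => -v p • X p.2)
    {γ : C(Icc (0 : ℝ) 1, ℝ × ℝ)} {x : ℝ × ℝ}
    (hγ : γ - primitive (superpose _ hV.continuous γ) = constPath x)
    (heq : ∀ t : Icc (0 : ℝ) 1, h (γ t) = u (t, γ t) * (F (γ t) + t * h (γ t)) +
      v (t, γ t) * (fderiv ℝ F (γ t) (X (γ t)) + t * fderiv ℝ h (γ t) (X (γ t)))) :
    F (γ 1) + h (γ 1) = Real.exp (total (superpose _ hu γ)) * F x := by
  obtain ⟨g, hg0, hgγ, hg⟩ := hasDerivAt_of_eq_add_primitive hγ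
  have key := eq_exp_total_mul (c := superpose _ hu γ) (y := fun t => F (g t) + t * h (g t))
    (by
      intro t
      have h1 := ((hF.differentiable (by simp) (g t)).hasFDerivAt).comp_hasDerivAt (t : ℝ) (hg t)
      have h2 := ((hh.differentiable (by simp) (g t)).hasFDerivAt).comp_hasDerivAt (t : ℝ) (hg t)
      refine (h1.add ((hasDerivAt_id (t : ℝ)).mul h2)).congr_deriv ?_
      have e2 : superpose _ hV.continuous γ t = -v (t, γ t) • X (γ t) := rfl
      have e3 : superpose _ hu γ t = u (t, γ t) := rfl
      rw [e2, e3, Function.comp_apply, hgγ, map_smul, map_smul, smul_eq_mul, smul_eq_mul, id]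
      linear_combination heq t)
  have h1 := hgγ 1
  simp only [Icc.coe_one] at h1
  simpa [h1, hg0] using key

theorem exists_conjugation {F h : ℝ × ℝ → ℝ} {u : ℝ × (ℝ × ℝ) → ℝ} (hX : ContDiff ℝ ∞ X)
    (hX0 : X 0 = 0) (hF : ContDiff ℝ ∞ F) (hh : ContDiff ℝ ∞ h) (hu : ContDiff ℝ ∞ u)
    (hv : ContDiff ℝ ∞ v) (hv0 : ∀ t, v (t, 0) = 0)
    (heq : ∀ᶠ x in 𝓝 (0 : ℝ × ℝ), ∀ t ∈ Icc (0 : ℝ) 1, h x = u (t, x) * (F x + t * h x) +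
      v (t, x) * (fderiv ℝ F x (X x) + t * fderiv ℝ h x (X x))) :
    ∃ (φ : ℝ × ℝ → ℝ × ℝ) (W : Set (ℝ × ℝ)) (κ lam : ℝ × ℝ → ℝ),
      IsOpen W ∧ (0 : ℝ × ℝ) ∈ W ∧ φ 0 = 0 ∧
      ContDiffOn ℝ ∞ φ W ∧ (∀ p ∈ W, (fderiv ℝ φ p).det ≠ 0) ∧
      ContDiffOn ℝ ∞ κ W ∧ (∀ p ∈ W, κ p ≠ 0) ∧
      ContDiffOn ℝ ∞ lam W ∧ (∀ p ∈ W, lam p ≠ 0) ∧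
      (∀ p ∈ W, ∀ w, omegaForm (X p) w = κ p * omegaForm (X (φ p)) (fderiv ℝ φ p w)) ∧
      (∀ p ∈ W, F p = lam p * (F (φ p) + h (φ p))) := by
  have hV : ContDiff ℝ ∞ fun p : ℝ × (ℝ × ℝ) => -v p • X p.2 :=
    hv.neg.smul (hX.comp contDiff_snd)
  have hc : ContDiff ℝ ∞ fun p : ℝ × (ℝ × ℝ) => -v p * planarDiv X p.2 :=
    hv.neg.mul ((contDiff_planarDiv hX).comp contDiff_snd)
  obtain ⟨Γ, W₀, hW₀, h0W₀, hΓ, hΓ0, hdΓ0, hflow⟩ := exists_smooth_flow hV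
    (fun t => by simp [hX0])
    (fun t => by
      refine ContinuousLinearMap.ext fun w => ?_
      rw [spaceDeriv_smul hv hX]
      simp [hX0, hv0])
  obtain ⟨r, hr, hball⟩ := Metric.mem_nhds_iff.1 heq
  let φ : ℝ × ℝ → ℝ × ℝ := fun x => evalPath 1 (Γ x)
  have hφ : ContDiffOn ℝ ∞ φ W₀ := (contDiff_evalPath 1).comp_contDiffOn hΓ
  have hfd : ∀ x ∈ W₀, HasFDerivAt Γ (fderiv ℝ Γ x) x := fun x hx =>
    ((hΓ.contDiffAt (hW₀.mem_nhds hx)).differentiableAt (by simp)).hasFDerivAt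
  have hφd : ∀ x ∈ W₀, fderiv ℝ φ x = (evalPath 1).comp (fderiv ℝ Γ x) := fun x hx =>
    ((hasFDerivAt_evalPath 1 (Γ x)).comp x (hfd x hx)).fderiv
  have hdet : ContinuousOn (fun x => (fderiv ℝ φ x).det) W₀ :=
    ContinuousLinearMap.continuous_det.comp_continuousOn
      (hφ.continuousOn_fderiv_of_isOpen hW₀ (by simp))
  have hdet0 : (fderiv ℝ φ 0).det ≠ 0 := by
    have : fderiv ℝ φ 0 = ContinuousLinearMap.id ℝ (ℝ × ℝ) := by
      rw [hφd 0 h0W₀, hdΓ0]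
      rfl
    rw [this]
    simp [ContinuousLinearMap.det]
  have hW₁ := hdet.isOpen_inter_preimage hW₀ (isOpen_compl_singleton (x := (0 : ℝ)))
  have hW₂ := hΓ.continuousOn.isOpen_inter_preimage hW₀
    (Metric.isOpen_ball (x := (0 : C(Icc (0 : ℝ) 1, ℝ × ℝ))) (ε := r))
  refine ⟨φ, (W₀ ∩ (fun x => (fderiv ℝ φ x).det) ⁻¹' {0}ᶜ) ∩ (W₀ ∩ Γ ⁻¹' Metric.ball 0 r),
    fun x => Real.exp (-total (superpose _ hc.continuous (Γ x))),
    fun x => Real.exp (-total (superpose _ hu.continuous (Γ x))),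
    hW₁.inter hW₂, ⟨⟨h0W₀, hdet0⟩, h0W₀, ?_⟩, ?_, hφ.mono fun x hx => hx.1.1,
    fun p hp => hp.1.2, ?_, fun p _ => (Real.exp_pos _).ne', ?_, fun p _ => (Real.exp_pos _).ne',
    ?_, ?_⟩
  · simpa [hΓ0] using hr
  · simp [φ, hΓ0]
  · exact ((contDiff_total.comp (contDiff_superpose hc)).comp_contDiffOn
      (hΓ.mono fun x hx => hx.1.1)).neg.exp
  · exact ((contDiff_total.comp (contDiff_superpose hu)).comp_contDiffOn
      (hΓ.mono fun x hx => hx.1.1)).neg.exp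
  · intro x hx w
    have hx0 := hx.1.1
    have hδ : (fderiv ℝ Γ x w) - primitive (applyPath (superpose _
        (contDiff_spaceDeriv (m := 0) hV (by simp)).continuous (Γ x)) (fderiv ℝ Γ x w)) =
        constPath w := by
      have h1 := (hasFDerivAt_defect hV (Γ x)).comp x (hfd x hx0)
      have h2 := (hasFDerivAt_constPath x).congr_of_eventuallyEq (f₁ := defect _ hV.continuous ∘ Γ)
        (by filter_upwards [hW₀.mem_nhds hx0] with y hy using hflow y hy)
      exact DFunLike.congr_fun (h1.unique h2) w
    have key := omegaForm_transport hX hv hV hc.continuous (hflow x hx0) hδ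
    rw [hφd x hx0]
    change _ = _ * omegaForm (X (Γ x 1)) (fderiv ℝ Γ x w 1)
    rw [key, ← mul_assoc, ← Real.exp_add]
    simp
  · intro x hx
    have key := function_transport hF hh hu.continuous hV (hflow x hx.1.1) (fun t =>
      hball (by
        have h1 := (Γ x).norm_coe_le_norm t
        have h2 : ‖Γ x‖ < r := by simpa using hx.2.2
        simpa using h1.trans_lt h2) t t.2)
    change _ = _ * (F (Γ x 1) + h (Γ x 1))
    rw [key, ← mul_assoc, ← Real.exp_add]
    simp

end PathSpace

/-- A function smooth on an open set agrees near a point of that set with a globally smooth one. -/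
theorem exists_contDiff_eventuallyEq {E G : Type*} [NormedAddCommGroup E] [NormedSpace ℝ E]
    [FiniteDimensional ℝ E] [NormedAddCommGroup G] [NormedSpace ℝ G] {F : E → G} {U : Set E}
    {x₀ : E} (hU : U ∈ 𝓝 x₀) (hF : ContDiffOn ℝ ∞ F U) :
    ∃ F' : E → G, ContDiff ℝ ∞ F' ∧ F' =ᶠ[𝓝 x₀] F := by
  obtain ⟨r, hr, hrU⟩ := Metric.mem_nhds_iff.1 hU
  let χ : ContDiffBump x₀ := ⟨r / 4, r / 2, by positivity, by linarith⟩
  refine ⟨fun x => χ x • F x, ?_, ?_⟩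
  · rw [contDiff_iff_contDiffAt]
    intro x
    by_cases hx : x ∈ Metric.ball x₀ r
    · exact χ.contDiffAt.smul (hF.contDiffAt (mem_of_superset (Metric.isOpen_ball.mem_nhds hx) hrU))
    · have hx' : x ∉ tsupport χ := by
        rw [χ.tsupport_eq]
        intro h
        rw [Metric.mem_closedBall] at h
        exact hx (Metric.mem_ball.2 (by change dist x x₀ ≤ r / 2 at h; linarith))
      refine contDiffAt_const (c := 0) |>.congr_of_eventuallyEq ?_
      filter_upwards [notMem_tsupport_iff_eventuallyEq.1 hx'] with y hy
      simp [hy]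
  · filter_upwards [χ.eventuallyEq_one] with x hx
    simp [hx]

/-- The algebra of smooth functions on the plane. -/
def SmoothFun : Subalgebra ℝ (ℝ × ℝ → ℝ) where
  carrier := {F | ContDiff ℝ ∞ F}
  mul_mem' := by
    intro F G (hF : ContDiff ℝ ∞ F) (hG : ContDiff ℝ ∞ G)
    exact Set.mem_ofPred.2 (hF.mul hG)
  add_mem' := by
    intro F G (hF : ContDiff ℝ ∞ F) (hG : ContDiff ℝ ∞ G)
    exact Set.mem_ofPred.2 (hF.add hG)
  algebraMap_mem' := fun c => Set.mem_ofPred.2 (contDiff_const (c := c))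

namespace SmoothFun

open PathSpace

theorem mem_iff {F : ℝ × ℝ → ℝ} : F ∈ SmoothFun ↔ ContDiff ℝ ∞ F := Iff.rfl

theorem contDiff (F : SmoothFun) : ContDiff ℝ ∞ F.1 := mem_iff.1 F.2

/-- The ideal of smooth functions vanishing at the origin. -/
def maxIdeal : Ideal SmoothFun := RingHom.ker
  ((Pi.evalRingHom (fun _ : ℝ × ℝ => ℝ) 0).comp SmoothFun.val.toRingHom)

theorem mem_maxIdeal {F : SmoothFun} : F ∈ maxIdeal ↔ F.1 0 = 0 := Iff.rfl

/-- The first coordinate. -/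
def coordFst : SmoothFun := ⟨Prod.fst, mem_iff.2 contDiff_fst⟩

/-- The second coordinate. -/
def coordSnd : SmoothFun := ⟨Prod.snd, mem_iff.2 contDiff_snd⟩

theorem coordFst_mem : coordFst ∈ maxIdeal := rfl

theorem coordSnd_mem : coordSnd ∈ maxIdeal := rfl

/-- The derivative in a constant direction. -/
def dirDeriv (e : ℝ × ℝ) (F : SmoothFun) : SmoothFun :=
  ⟨fun x => fderiv ℝ F.1 x e,
    mem_iff.2 (((contDiff F).fderiv_right (m := ∞) (by simp)).clm_apply contDiff_const)⟩

/-- The weighted average `x ↦ ∫₀¹ sʲ F (s x) ds` over the segment from the origin to `x`. -/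
def radialAvg (j : ℕ) (F : SmoothFun) : SmoothFun :=
  ⟨fun x => ∫ s in (0 : ℝ)..1, s ^ j * F.1 (s • x), by
    have hV : ContDiff ℝ ∞ fun p : ℝ × (ℝ × ℝ) => p.1 ^ j * F.1 (p.1 • p.2) :=
      (contDiff_fst.pow j).mul ((contDiff F).comp (contDiff_fst.smul contDiff_snd))
    have h := ContDiff.comp (contDiff_total (F := ℝ))
      ((contDiff_superpose hV).comp contDiff_constPath)
    refine mem_iff.2 ((congrArg (ContDiff ℝ ∞) (funext fun x => ?_)).mp h)
    refine intervalIntegral.integral_congr fun s hs => ?_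
    have hs' : s ∈ Icc (0 : ℝ) 1 := uIcc_of_le (zero_le_one (α := ℝ)) ▸ hs
    exact IccExtend_of_mem _ _ hs'⟩

theorem continuous_radial (j : ℕ) (F : SmoothFun) (x : ℝ × ℝ) :
    Continuous fun s : ℝ => s ^ j * F.1 (s • x) := by
  have := (contDiff F).continuous
  fun_prop

theorem radialAvg_add (j : ℕ) (F G : SmoothFun) :
    radialAvg j (F + G) = radialAvg j F + radialAvg j G := by
  ext x
  change ∫ s in (0 : ℝ)..1, s ^ j * (F.1 (s • x) + G.1 (s • x)) = _
  simp_rw [mul_add]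
  exact intervalIntegral.integral_add ((continuous_radial j F x).intervalIntegrable _ _)
    ((continuous_radial j G x).intervalIntegrable _ _)

theorem radialAvg_mul_of_homogeneous (j : ℕ) {P : SmoothFun} (F : SmoothFun)
    (hP : ∀ (s : ℝ) x, P.1 (s • x) = s * P.1 x) :
    radialAvg j (P * F) = P * radialAvg (j + 1) F := by
  ext x
  change ∫ s in (0 : ℝ)..1, s ^ j * (P.1 (s • x) * F.1 (s • x)) =
    P.1 x * ∫ s in (0 : ℝ)..1, s ^ (j + 1) * F.1 (s • x)
  rw [← intervalIntegral.integral_const_mul]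
  congr 1
  ext s
  rw [hP]
  ring

/-- Hadamard's lemma. -/
theorem eq_coord_mul_add {F : SmoothFun} (hF : F.1 0 = 0) :
    F = coordFst * radialAvg 0 (dirDeriv (1, 0) F) +
      coordSnd * radialAvg 0 (dirDeriv (0, 1) F) := by
  ext x
  have hd : ∀ s : ℝ, HasDerivAt (fun s : ℝ => F.1 (s • x))
      (x.1 * (s ^ 0 * fderiv ℝ F.1 (s • x) (1, 0)) +
        x.2 * (s ^ 0 * fderiv ℝ F.1 (s • x) (0, 1))) s := by
    intro s
    have h1 : HasDerivAt (fun s : ℝ => s • x) x s := by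
      simpa using (hasDerivAt_id s).smul_const x
    have hF' := ((contDiff F).differentiable (by simp) (s • x)).hasFDerivAt
    refine (hF'.comp_hasDerivAt s h1).congr_deriv ?_
    have hx : x = x.1 • ((1 : ℝ), (0 : ℝ)) + x.2 • ((0 : ℝ), (1 : ℝ)) := by simp
    have := congrArg (fderiv ℝ F.1 (s • x)) hx
    rw [map_add, map_smul, map_smul] at this
    simpa using this
  have c1 : Continuous fun s : ℝ => x.1 * (s ^ 0 * fderiv ℝ F.1 (s • x) (1, 0)) :=
    (continuous_radial 0 (dirDeriv (1, 0) F) x).const_mul x.1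
  have c2 : Continuous fun s : ℝ => x.2 * (s ^ 0 * fderiv ℝ F.1 (s • x) (0, 1)) :=
    (continuous_radial 0 (dirDeriv (0, 1) F) x).const_mul x.2
  have := intervalIntegral.integral_eq_sub_of_hasDerivAt (a := 0) (b := 1) (fun s _ => hd s)
    ((c1.intervalIntegrable _ _).add (c2.intervalIntegrable _ _))
  rw [one_smul, zero_smul, hF, sub_zero, intervalIntegral.integral_add
    (c1.intervalIntegrable _ _) (c2.intervalIntegrable _ _),
    intervalIntegral.integral_const_mul, intervalIntegral.integral_const_mul] at this
  exact this.symm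

theorem radialAvg_mem_pow (k : ℕ) : ∀ (j : ℕ) {F : SmoothFun}, F ∈ maxIdeal ^ k →
    radialAvg j F ∈ maxIdeal ^ k := by
  induction k with
  | zero => simp
  | succ k ih =>
    intro j F hF
    rw [pow_succ'] at hF ⊢
    induction hF using Submodule.mul_induction_on' with
    | mem_mul_mem A hA B hB =>
      obtain ⟨A₁, A₂, rfl⟩ : ∃ A₁ A₂, A = coordFst * A₁ + coordSnd * A₂ :=
        ⟨_, _, eq_coord_mul_add (mem_maxIdeal.1 hA)⟩
      rw [add_mul, radialAvg_add, mul_assoc, mul_assoc,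
        radialAvg_mul_of_homogeneous (P := coordFst) _ _ fun _ _ => rfl,
        radialAvg_mul_of_homogeneous (P := coordSnd) _ _ fun _ _ => rfl]
      exact add_mem
        (Ideal.mul_mem_mul coordFst_mem (ih _ (Ideal.mul_mem_left _ _ hB)))
        (Ideal.mul_mem_mul coordSnd_mem (ih _ (Ideal.mul_mem_left _ _ hB)))
    | add A _ B _ hA hB =>
      rw [radialAvg_add]
      exact add_mem hA hB

theorem mem_pow_succ {k : ℕ} {F : SmoothFun} (h0 : F.1 0 = 0)
    (h : ∀ e, dirDeriv e F ∈ maxIdeal ^ k) : F ∈ maxIdeal ^ (k + 1) := by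
  rw [eq_coord_mul_add h0, pow_succ']
  exact add_mem (Ideal.mul_mem_mul coordFst_mem (radialAvg_mem_pow k 0 (h _)))
    (Ideal.mul_mem_mul coordSnd_mem (radialAvg_mem_pow k 0 (h _)))

/-- The Taylor polynomial as a smooth function. -/
def jetFun (k : ℕ) (F : SmoothFun) : SmoothFun :=
  ⟨jet k F.1, mem_iff.2 (ContDiff.sum fun i _ => contDiff_const.mul
    ((iteratedFDeriv ℝ i F.1 0).contDiff.comp (contDiff_pi.2 fun _ => contDiff_id)))⟩

theorem jetFun_apply_zero (k : ℕ) (F : SmoothFun) : (jetFun k F).1 0 = F.1 0 := by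
  change jet k F.1 0 = F.1 0
  unfold jet
  rw [Finset.sum_eq_single 0]
  · simp
  · intro i _ hi
    have : (iteratedFDeriv ℝ i F.1 0) (fun _ => 0) = 0 :=
      (iteratedFDeriv ℝ i F.1 0).map_coord_zero (⟨0, Nat.pos_of_ne_zero hi⟩ : Fin i) rfl
    rw [this, mul_zero]
  · simp

theorem dirDeriv_comm (e e' : ℝ × ℝ) (F : SmoothFun) :
    dirDeriv e (dirDeriv e' F) = dirDeriv e' (dirDeriv e F) := by
  ext x
  have hd : DifferentiableAt ℝ (fderiv ℝ F.1) x :=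
    ((contDiff F).fderiv_right (m := ∞) (by simp)).differentiable (by simp) x
  have key : ∀ a b, (dirDeriv a (dirDeriv b F)).1 x = fderiv ℝ (fderiv ℝ F.1) x a b := fun a b => by
    change fderiv ℝ (fun y => fderiv ℝ F.1 y b) x a = _
    rw [fderiv_clm_apply hd (differentiableAt_const b)]
    simp
  rw [key, key]
  exact ((contDiff F).contDiffAt.isSymmSndFDerivAt
    (by simpa using WithTop.coe_le_coe.2 (le_top : (2 : ℕ∞) ≤ ⊤))).eq e e'

theorem iteratedFDeriv_succ_apply (F : SmoothFun) (n : ℕ) (m : Fin (n + 1) → ℝ × ℝ) :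
    iteratedFDeriv ℝ (n + 1) F.1 0 m =
      iteratedFDeriv ℝ n (dirDeriv (m (Fin.last n)) F).1 0 (Fin.init m) := by
  rw [iteratedFDeriv_succ_apply_right]
  exact (iteratedFDeriv_clm_apply_const_apply (n := (n : WithTop ℕ∞))
    (((contDiff F).fderiv_right (m := ∞) (by simp)).of_le (by exact_mod_cast le_top)) le_rfl).symm

theorem iteratedFDeriv_update (p e : ℝ × ℝ) (n : ℕ) : ∀ (F : SmoothFun) (i : Fin (n + 1)),
    iteratedFDeriv ℝ (n + 1) F.1 0 (Function.update (fun _ => p) i e) =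
      iteratedFDeriv ℝ n (dirDeriv e F).1 0 (fun _ => p) := by
  have hlast : ∀ n (F : SmoothFun),
      iteratedFDeriv ℝ (n + 1) F.1 0 (Function.update (fun _ => p) (Fin.last n) e) =
        iteratedFDeriv ℝ n (dirDeriv e F).1 0 (fun _ => p) := fun n F => by
    rw [iteratedFDeriv_succ_apply, Function.update_self, Fin.init_update_last]
    rfl
  induction n with
  | zero => exact fun F i => (show Fin.last 0 = i from (Fin.eq_zero i).symm) ▸ hlast 0 F
  | succ n ih =>
    intro F i
    induction i using Fin.lastCases with
    | last => exact hlast _ F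
    | cast i =>
      rw [iteratedFDeriv_succ_apply, Fin.init_update_castSucc,
        Function.update_of_ne (Fin.castSucc_lt_last i).ne']
      refine (ih _ i).trans ?_
      rw [dirDeriv_comm, iteratedFDeriv_succ_apply]
      rfl

theorem dirDeriv_jetFun (k : ℕ) (e : ℝ × ℝ) (F : SmoothFun) :
    dirDeriv e (jetFun (k + 1) F) = jetFun k (dirDeriv e F) := by
  ext p
  have hterm : ∀ i : ℕ, HasFDerivAt
      (fun p : ℝ × ℝ => ((i.factorial : ℝ))⁻¹ * iteratedFDeriv ℝ i F.1 0 (fun _ => p))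
      (((i.factorial : ℝ))⁻¹ • ((iteratedFDeriv ℝ i F.1 0).linearDeriv (fun _ => p)).comp
        (ContinuousLinearMap.pi fun _ => ContinuousLinearMap.id ℝ (ℝ × ℝ))) p := fun i =>
    (((iteratedFDeriv ℝ i F.1 0).hasFDerivAt (fun _ => p)).comp p
      ((ContinuousLinearMap.pi fun _ : Fin i =>
        ContinuousLinearMap.id ℝ (ℝ × ℝ)).hasFDerivAt)).const_mul _
  have hsum := HasFDerivAt.fun_sum (u := Finset.range (k + 1 + 1)) fun i _ => hterm i
  change fderiv ℝ (jet (k + 1) F.1) p e = jet k (dirDeriv e F).1 p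
  unfold jet
  rw [hsum.fderiv, sum_apply, Finset.sum_range_succ']
  simp only [smul_apply, ContinuousLinearMap.comp_apply,
    ContinuousMultilinearMap.linearDeriv_apply, ContinuousLinearMap.pi_apply,
    ContinuousLinearMap.id_apply, iteratedFDeriv_update, Finset.sum_const, Finset.card_univ,
    Fintype.card_fin, smul_eq_mul, nsmul_eq_mul]
  simp only [Finset.univ_eq_empty, Finset.sum_empty, mul_zero, add_zero]
  refine Finset.sum_congr rfl fun i _ => ?_
  rw [Nat.factorial_succ]
  push_cast
  have h1 : ((i : ℝ) + 1) ≠ 0 := by positivity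
  have h2 : (i.factorial : ℝ) ≠ 0 := by positivity
  field_simp

theorem dirDeriv_sub (e : ℝ × ℝ) (F G : SmoothFun) :
    dirDeriv e (F - G) = dirDeriv e F - dirDeriv e G := by
  ext x
  have := fderiv_sub ((contDiff F).differentiable (by simp) x)
    ((contDiff G).differentiable (by simp) x)
  exact DFunLike.congr_fun this e

/-- Taylor's theorem: a function differs from its `k`-jet by an element of `𝔪ᵏ⁺¹`. -/
theorem jetFun_sub_mem (k : ℕ) : ∀ F : SmoothFun, jetFun k F - F ∈ maxIdeal ^ (k + 1) := by
  have h0 : ∀ k F, (jetFun k F - F).1 0 = 0 := fun k F => by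
    change (jetFun k F).1 0 - F.1 0 = 0
    rw [jetFun_apply_zero, sub_self]
  induction k with
  | zero => exact fun F => by simpa using mem_maxIdeal.2 (h0 0 F)
  | succ k ih =>
    refine fun F => mem_pow_succ (h0 _ F) fun e => ?_
    rw [dirDeriv_sub, dirDeriv_jetFun]
    exact ih _

end SmoothFun

/-- If `I` has codimension at most `k` over a field and elements of `1 + 𝔪` are non-zero-divisors
modulo `I`, then `𝔪ᵏ ≤ I`. -/
theorem Ideal.pow_le_of_span_sup_eq_top {𝕜 R : Type*} [Field 𝕜] [CommRing R] [Algebra 𝕜 R]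
    {m I : Ideal R} (hm : m.FG) {k : ℕ} (c : Fin k → R)
    (hspan : Submodule.span 𝕜 (range c) ⊔ I.restrictScalars 𝕜 = ⊤)
    (hunit : ∀ r x : R, r - 1 ∈ m → r * x ∈ I → x ∈ I) : m ^ k ≤ I := by
  set π := (I.restrictScalars 𝕜).mkQ with hπ
  have htop : Submodule.span 𝕜 (range (π ∘ c)) = ⊤ := by
    rw [range_comp, Submodule.span_image]
    exact (Submodule.map_mkQ_eq_top _ _).2 (by rw [sup_comm]; exact hspan)
  have hfin : FiniteDimensional 𝕜 (R ⧸ I.restrictScalars 𝕜) :=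
    ⟨⟨(finite_range (π ∘ c)).toFinset, by simpa using htop⟩⟩
  have hrank : Module.finrank 𝕜 (R ⧸ I.restrictScalars 𝕜) ≤ k := by
    rw [← finrank_top, ← htop]
    simpa [Set.finrank] using finrank_range_le_card (R := 𝕜) (π ∘ c)
  let p : ℕ → Submodule 𝕜 (R ⧸ I.restrictScalars 𝕜) := fun j => ((m ^ j).restrictScalars 𝕜).map π
  have hp : ∀ j, p (j + 1) ≤ p j := fun j =>
    Submodule.map_mono fun x hx => Ideal.pow_le_pow_right j.le_succ hx
  obtain ⟨j, hjk, hj⟩ : ∃ j ≤ k, p (j + 1) = p j := by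
    by_contra! h
    have hlt : ∀ j ≤ k + 1, Module.finrank 𝕜 (p j) + j ≤ k := by
      intro j
      induction j with
      | zero => exact fun _ => (Submodule.finrank_le _).trans hrank
      | succ j ih =>
        intro hj
        have := Submodule.finrank_lt_finrank_of_lt ((hp j).lt_of_ne (h j (by omega)))
        have := ih (by omega)
        omega
    have := hlt (k + 1) le_rfl
    omega
  have hle : m ^ j ≤ I ⊔ m • m ^ j := by
    intro x hx
    have hx' : π x ∈ p (j + 1) := hj ▸ Submodule.mem_map_of_mem hx
    obtain ⟨y, hy, hxy⟩ := hx'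
    have hsub : x - y ∈ I := by
      have := (Submodule.Quotient.eq (I.restrictScalars 𝕜)).1 hxy.symm
      exact this
    rw [smul_eq_mul, ← pow_succ']
    exact Submodule.mem_sup.2 ⟨x - y, hsub, y, hy, sub_add_cancel x y⟩
  obtain ⟨r, hr, hrI⟩ :=
    Submodule.exists_sub_one_mem_and_smul_le_of_fg_of_le_sup hm.pow le_rfl hle
  exact (Ideal.pow_le_pow_right hjk).trans fun x hx =>
    hunit r x hr (hrI (Submodule.smul_mem_pointwise_smul x r _ hx))

namespace SmoothFun

theorem exists_eventuallyEq {F : ℝ × ℝ → ℝ} {U : Set (ℝ × ℝ)} (hU : U ∈ 𝓝 0)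
    (hF : ContDiffOn ℝ ∞ F U) : ∃ G : SmoothFun, G.1 =ᶠ[𝓝 0] F :=
  let ⟨G, hG, h⟩ := exists_contDiff_eventuallyEq hU hF
  ⟨⟨G, mem_iff.2 hG⟩, h⟩

/-- The smooth functions whose germ at the origin lies in the ideal generated by `P` and `Q`. -/
def germIdeal (P Q : SmoothFun) : Ideal SmoothFun where
  carrier := {F | ∃ u v : SmoothFun, F.1 =ᶠ[𝓝 0] (u * P + v * Q).1}
  add_mem' := by
    rintro F G ⟨u, v, hF⟩ ⟨u', v', hG⟩
    refine ⟨u + u', v + v', ?_⟩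
    rw [show (u + u') * P + (v + v') * Q = (u * P + v * Q) + (u' * P + v' * Q) by ring]
    exact hF.add hG
  zero_mem' := ⟨0, 0, by simp⟩
  smul_mem' := by
    rintro w F ⟨u, v, hF⟩
    refine ⟨w * u, w * v, ?_⟩
    rw [show w * u * P + w * v * Q = w * (u * P + v * Q) by ring]
    exact (EventuallyEq.refl _ w.1).mul hF

theorem mem_germIdeal {P Q F : SmoothFun} :
    F ∈ germIdeal P Q ↔ ∃ u v : SmoothFun, F.1 =ᶠ[𝓝 0] (u * P + v * Q).1 := Iff.rfl

theorem mem_germIdeal_of_eventuallyEq {P Q F G : SmoothFun} (h : F.1 =ᶠ[𝓝 0] G.1)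
    (hG : G ∈ germIdeal P Q) : F ∈ germIdeal P Q :=
  let ⟨u, v, huv⟩ := mem_germIdeal.1 hG
  mem_germIdeal.2 ⟨u, v, h.trans huv⟩

theorem maxIdeal_eq_span : maxIdeal = Ideal.span {coordFst, coordSnd} := by
  refine le_antisymm (fun F hF => ?_) (Ideal.span_le.2 ?_)
  · rw [eq_coord_mul_add (mem_maxIdeal.1 hF)]
    exact add_mem (Ideal.mul_mem_right _ _ (Ideal.subset_span (by simp)))
      (Ideal.mul_mem_right _ _ (Ideal.subset_span (by simp)))
  · rintro F (rfl | rfl)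
    exacts [coordFst_mem, coordSnd_mem]

theorem maxIdeal_fg : maxIdeal.FG := maxIdeal_eq_span ▸ Submodule.fg_span (by simp)

/-- A function not vanishing at the origin has a multiplicative inverse near it. -/
theorem exists_inverse {r : SmoothFun} (hr : r.1 0 ≠ 0) :
    ∃ s : SmoothFun, (s * r).1 =ᶠ[𝓝 0] 1 := by
  have hr' : ∀ᶠ x in 𝓝 0, r.1 x ≠ 0 := (contDiff r).continuous.continuousAt.eventually_ne hr
  obtain ⟨s, hs⟩ := exists_eventuallyEq (F := fun x => (r.1 x)⁻¹) (U := {x | r.1 x ≠ 0}) hr'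
    ((contDiff r).contDiffOn.inv fun x hx => hx)
  refine ⟨s, ?_⟩
  filter_upwards [hs, hr'] with x hx hrx
  change s.1 x * r.1 x = 1
  rw [hx, inv_mul_cancel₀ hrx]

theorem mem_germIdeal_of_mul_mem {P Q r F : SmoothFun} (hr : r - 1 ∈ maxIdeal)
    (h : r * F ∈ germIdeal P Q) : F ∈ germIdeal P Q := by
  have hr0 : r.1 0 = 1 := sub_eq_zero.1 (mem_maxIdeal.1 hr)
  obtain ⟨s, hs⟩ := exists_inverse (r := r) (by rw [hr0]; exact one_ne_zero)
  refine mem_germIdeal_of_eventuallyEq ?_ (Ideal.mul_mem_left _ s h)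
  filter_upwards [hs] with x hx
  change s.1 x * r.1 x = 1 at hx
  change F.1 x = s.1 x * (r.1 x * F.1 x)
  rw [← mul_assoc, hx, one_mul]

theorem exists_eq_of_mem_mul {P Q F : SmoothFun} (hF : F ∈ maxIdeal * germIdeal P Q) :
    ∃ α ∈ maxIdeal, ∃ β ∈ maxIdeal, F.1 =ᶠ[𝓝 0] (α * P + β * Q).1 := by
  induction hF using Submodule.mul_induction_on' with
  | mem_mul_mem A hA B hB =>
    obtain ⟨u, v, h⟩ := mem_germIdeal.1 hB
    refine ⟨A * u, Ideal.mul_mem_right _ _ hA, A * v, Ideal.mul_mem_right _ _ hA, ?_⟩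
    rw [show A * u * P + A * v * Q = A * (u * P + v * Q) by ring]
    exact (EventuallyEq.refl _ A.1).mul h
  | add A _ B _ hA hB =>
    obtain ⟨α, hα, β, hβ, h⟩ := hA
    obtain ⟨α', hα', β', hβ', h'⟩ := hB
    refine ⟨α + α', add_mem hα hα', β + β', add_mem hβ hβ', ?_⟩
    rw [show (α + α') * P + (β + β') * Q = (α * P + β * Q) + (α' * P + β' * Q) by ring]
    exact h.add h'

/-- Perturbing the generators of an ideal by elements of `𝔪` times it does not change the ideal,
with coefficients depending smoothly on the perturbation parameter. -/
theorem exists_coeff_of_mem_mul {P Q H K : SmoothFun} (hH : H ∈ maxIdeal * germIdeal P Q)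
    (hK : K ∈ maxIdeal * germIdeal P Q) :
    ∃ u v : ℝ × (ℝ × ℝ) → ℝ, ContDiff ℝ ∞ u ∧ ContDiff ℝ ∞ v ∧ (∀ t, v (t, 0) = 0) ∧
      ∀ᶠ x in 𝓝 0, ∀ t ∈ Icc (0 : ℝ) 1,
        H.1 x = u (t, x) * (P.1 x + t * H.1 x) + v (t, x) * (Q.1 x + t * K.1 x) := by
  obtain ⟨α, hα, β, hβ, hH⟩ := exists_eq_of_mem_mul hH
  obtain ⟨γ, hγ, δ, hδ, hK⟩ := exists_eq_of_mem_mul hK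
  obtain ⟨ρ, hρ, hρ1⟩ := exists_contDiff_eventuallyEq (F := fun y : ℝ => y⁻¹) (U := {y | y ≠ 0})
    (isOpen_ne.mem_nhds (one_ne_zero (α := ℝ))) (contDiffOn_id.inv fun _ h => h)
  have hα' := (contDiff α).comp (contDiff_snd (E := ℝ) (F := ℝ × ℝ))
  have hβ' := (contDiff β).comp (contDiff_snd (E := ℝ) (F := ℝ × ℝ))
  have hγ' := (contDiff γ).comp (contDiff_snd (E := ℝ) (F := ℝ × ℝ))
  have hδ' := (contDiff δ).comp (contDiff_snd (E := ℝ) (F := ℝ × ℝ))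
  have ht : ContDiff ℝ ∞ (Prod.fst : ℝ × (ℝ × ℝ) → ℝ) := contDiff_fst
  let D : ℝ × (ℝ × ℝ) → ℝ := fun p =>
    (1 + p.1 * α.1 p.2) * (1 + p.1 * δ.1 p.2) - p.1 * β.1 p.2 * (p.1 * γ.1 p.2)
  have hD : ContDiff ℝ ∞ D :=
    ((contDiff_const.add (ht.mul hα')).mul (contDiff_const.add (ht.mul hδ'))).sub
      ((ht.mul hβ').mul (ht.mul hγ'))
  refine ⟨fun p => (α.1 p.2 * (1 + p.1 * δ.1 p.2) - β.1 p.2 * (p.1 * γ.1 p.2)) * ρ (D p),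
    fun p => β.1 p.2 * ρ (D p), ?_, hβ'.mul (hρ.comp hD), fun t => ?_, ?_⟩
  · exact ((hα'.mul (contDiff_const.add (ht.mul hδ'))).sub (hβ'.mul (ht.mul hγ'))).mul
      (hρ.comp hD)
  · simp [mem_maxIdeal.1 hβ]
  · have hD0 : ∀ t, D (t, 0) = 1 := fun t => by
      simp [D, mem_maxIdeal.1 hα, mem_maxIdeal.1 hβ, mem_maxIdeal.1 hδ]
    have hnear : ∀ᶠ y in 𝓝 (1 : ℝ), ρ y * y = 1 := by
      filter_upwards [hρ1, eventually_ne_nhds (one_ne_zero (α := ℝ))] with y hy hy0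
      rw [hy, inv_mul_cancel₀ hy0]
    have hunif : ∀ᶠ x in 𝓝 (0 : ℝ × ℝ), ∀ t ∈ Icc (0 : ℝ) 1, ρ (D (t, x)) * D (t, x) = 1 :=
      isCompact_Icc.eventually_forall_of_forall_eventually fun t _ => by
        have hc := hD.continuous.comp (continuous_swap (X := ℝ × ℝ) (Y := ℝ))
        have hc0 := hc.continuousAt (x := (0, t))
        exact hc0.eventually (by
          rw [show (D ∘ Prod.swap) ((0 : ℝ × ℝ), t) = 1 from hD0 t]
          exact hnear)
    filter_upwards [hH, hK, hunif] with x hHx hKx hx t htI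
    have h1 := hx t htI
    change H.1 x = α.1 x * P.1 x + β.1 x * Q.1 x at hHx
    change K.1 x = γ.1 x * P.1 x + δ.1 x * Q.1 x at hKx
    simp only [D] at h1 ⊢
    rw [hHx, hKx]
    linear_combination (-(α.1 x * P.1 x + β.1 x * Q.1 x)) * h1

theorem pow_le_germIdeal {P Q : SmoothFun} {k : ℕ} (c : Fin k → SmoothFun)
    (h : ∀ F : SmoothFun, ∃ a : Fin k → ℝ, F - ∑ i, a i • c i ∈ germIdeal P Q) :
    maxIdeal ^ k ≤ germIdeal P Q := by
  refine Ideal.pow_le_of_span_sup_eq_top (𝕜 := ℝ) maxIdeal_fg c ?_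
    fun r F => mem_germIdeal_of_mul_mem
  refine Submodule.eq_top_iff'.2 fun F => ?_
  obtain ⟨a, ha⟩ := h F
  exact Submodule.mem_sup.2 ⟨∑ i, a i • c i,
    Submodule.sum_mem _ fun i _ => Submodule.smul_mem _ _ (Submodule.subset_span ⟨i, rfl⟩),
    _, ha, add_sub_cancel _ _⟩

/-- The derivative along a vector field with smooth components `X₁`, `X₂`. -/
def lieDeriv (X₁ X₂ F : SmoothFun) : SmoothFun :=
  X₁ * dirDeriv (1, 0) F + X₂ * dirDeriv (0, 1) F

theorem lieDeriv_apply (X₁ X₂ F : SmoothFun) (x : ℝ × ℝ) :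
    (lieDeriv X₁ X₂ F).1 x = fderiv ℝ F.1 x (X₁.1 x, X₂.1 x) := by
  have hx : (X₁.1 x, X₂.1 x) = X₁.1 x • ((1 : ℝ), (0 : ℝ)) + X₂.1 x • ((0 : ℝ), (1 : ℝ)) := by simp
  rw [hx, map_add, map_smul, map_smul]
  rfl

theorem lieDeriv_jetFun_sub_mem {X₁ X₂ : SmoothFun} (h₁ : X₁ ∈ maxIdeal) (h₂ : X₂ ∈ maxIdeal)
    (k : ℕ) (F : SmoothFun) :
    lieDeriv X₁ X₂ (jetFun (k + 1) F - F) ∈ maxIdeal ^ (k + 2) := by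
  have hd : ∀ e, dirDeriv e (jetFun (k + 1) F - F) ∈ maxIdeal ^ (k + 1) := fun e => by
    rw [dirDeriv_sub, dirDeriv_jetFun]
    exact jetFun_sub_mem k _
  rw [pow_succ']
  exact add_mem (Ideal.mul_mem_mul h₁ (hd _)) (Ideal.mul_mem_mul h₂ (hd _))

end SmoothFun

theorem eq_of_omegaForm {w : ℝ × ℝ} {b : ℝ × ℝ →L[ℝ] ℝ} (h : ∀ v, omegaForm w v = b v) :
    w = (b (0, 1), -b (1, 0)) := by
  have h1 := h (0, 1)
  have h2 := h (1, 0)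
  simp only [omegaForm, mul_one, mul_zero, sub_zero, zero_sub] at h1 h2
  exact Prod.ext h1 (by rw [← h2, neg_neg])

theorem jet_congr {f g : ℝ × ℝ → ℝ} (h : f =ᶠ[𝓝 0] g) (k : ℕ) : jet k f = jet k g := by
  funext p
  exact Finset.sum_congr rfl fun i _ => by rw [(h.iteratedFDeriv ℝ i).eq_of_nhds]

namespace SmoothFun

/-- A function whose germ ideal contains `𝔪ᵏ` is conjugate to its `k`-jet. -/
theorem exists_conjugation_jet {X₁ X₂ P : SmoothFun} (h₁ : X₁ ∈ maxIdeal) (h₂ : X₂ ∈ maxIdeal)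
    {k : ℕ} (hk : maxIdeal ^ (k + 1) ≤ germIdeal P (lieDeriv X₁ X₂ P)) :
    ∃ (φ : ℝ × ℝ → ℝ × ℝ) (W : Set (ℝ × ℝ)) (κ lam : ℝ × ℝ → ℝ),
      IsOpen W ∧ (0 : ℝ × ℝ) ∈ W ∧ φ 0 = 0 ∧
      ContDiffOn ℝ ∞ φ W ∧ (∀ p ∈ W, (fderiv ℝ φ p).det ≠ 0) ∧
      ContDiffOn ℝ ∞ κ W ∧ (∀ p ∈ W, κ p ≠ 0) ∧
      ContDiffOn ℝ ∞ lam W ∧ (∀ p ∈ W, lam p ≠ 0) ∧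
      (∀ p ∈ W, ∀ w, omegaForm (X₁.1 p, X₂.1 p) w =
        κ p * omegaForm (X₁.1 (φ p), X₂.1 (φ p)) (fderiv ℝ φ p w)) ∧
      (∀ p ∈ W, P.1 p = lam p * jet (k + 1) P.1 (φ p)) := by
  have hle : maxIdeal ^ (k + 2) ≤ maxIdeal * germIdeal P (lieDeriv X₁ X₂ P) := by
    rw [pow_succ']
    exact Ideal.mul_mono_right hk
  obtain ⟨u, v, hu, hv, hv0, huv⟩ := exists_coeff_of_mem_mul
    (hle (jetFun_sub_mem (k + 1) P)) (hle (lieDeriv_jetFun_sub_mem h₁ h₂ k P))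
  obtain ⟨φ, W, κ, lam, hW, h0, hφ0, hφ, hdet, hκ, hκ0, hlam, hlam0, hω, hP⟩ :=
    PathSpace.exists_conjugation (X := fun x => (X₁.1 x, X₂.1 x)) (F := P.1)
      (h := (jetFun (k + 1) P - P).1) ((contDiff X₁).prodMk (contDiff X₂))
      (Prod.ext h₁ h₂) (contDiff P) (contDiff _) hu hv hv0 (by
        filter_upwards [huv] with x hx t ht
        simpa only [lieDeriv_apply] using hx t ht)
  refine ⟨φ, W, κ, lam, hW, h0, hφ0, hφ, hdet, hκ, hκ0, hlam, hlam0, hω, fun p hp => ?_⟩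
  rw [hP p hp]
  congr 1
  exact add_sub_cancel _ _

end SmoothFun

end Preliminaries

/-- Let `a` be a smooth 1-form near `0 ∈ ℝ²` singular at the origin (`a(0) = 0`),
with corresponding vector field `X_a`, and let `f` be smooth with `f(0,0) = 0` and
Lie derivative `Lf(p) = df(p)(X_a(p))`. If `f` has finite codimension `k` — i.e.
there are smooth `e₁, …, e_k` such that every smooth germ `F` can be written
`F = Σ cᵢ·eᵢ + u·f + v·Lf` with uniquely determined constants `cᵢ` — then `f` is
`K_a`-equivalent to its `k`-jet: there are a local diffeomorphism `φ` fixing `0`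
and smooth nonvanishing `κ, λ` with `a = κ·φ*(a)` and `f = λ·((j^k f) ∘ φ)` near
the origin. -/
theorem stmt_19 (k : ℕ) (U : Set (ℝ × ℝ)) (hUo : IsOpen U) (hU0 : (0 : ℝ × ℝ) ∈ U)
    (a : ℝ × ℝ → ((ℝ × ℝ) →L[ℝ] ℝ)) (ha : ContDiffOn ℝ (⊤ : ℕ∞) a U)
    (ha0 : a 0 = 0)
    (Xa : ℝ × ℝ → ℝ × ℝ) (hXa : ∀ p v, omegaForm (Xa p) v = a p v)
    (f : ℝ × ℝ → ℝ) (hf : ContDiffOn ℝ (⊤ : ℕ∞) f U) (hf0 : f 0 = 0)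
    (Lf : ℝ × ℝ → ℝ) (hLf : ∀ p, Lf p = fderiv ℝ f p (Xa p))
    -- f has finite codimension k:
    (e : Fin k → (ℝ × ℝ → ℝ)) (he : ∀ i, ContDiffOn ℝ (⊤ : ℕ∞) (e i) U)
    (hdiv : ∀ (F : ℝ × ℝ → ℝ) (UF : Set (ℝ × ℝ)), IsOpen UF → (0 : ℝ × ℝ) ∈ UF →
      ContDiffOn ℝ (⊤ : ℕ∞) F UF →
      ∃ (c : Fin k → ℝ) (W : Set (ℝ × ℝ)), IsOpen W ∧ (0 : ℝ × ℝ) ∈ W ∧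
        ∃ u v : ℝ × ℝ → ℝ, ContDiffOn ℝ (⊤ : ℕ∞) u W ∧ ContDiffOn ℝ (⊤ : ℕ∞) v W ∧
          ∀ p ∈ W, F p = (∑ i : Fin k, c i * e i p) + u p * f p + v p * Lf p)
    (huniq : ∀ (F : ℝ × ℝ → ℝ) (c c' : Fin k → ℝ),
      (∃ W : Set (ℝ × ℝ), IsOpen W ∧ (0 : ℝ × ℝ) ∈ W ∧
        ∃ u v : ℝ × ℝ → ℝ, ContDiffOn ℝ (⊤ : ℕ∞) u W ∧ ContDiffOn ℝ (⊤ : ℕ∞) v W ∧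
          ∀ p ∈ W, F p = (∑ i : Fin k, c i * e i p) + u p * f p + v p * Lf p) →
      (∃ W : Set (ℝ × ℝ), IsOpen W ∧ (0 : ℝ × ℝ) ∈ W ∧
        ∃ u v : ℝ × ℝ → ℝ, ContDiffOn ℝ (⊤ : ℕ∞) u W ∧ ContDiffOn ℝ (⊤ : ℕ∞) v W ∧
          ∀ p ∈ W, F p = (∑ i : Fin k, c' i * e i p) + u p * f p + v p * Lf p) →
      c = c') :
    ∃ (φ : ℝ × ℝ → ℝ × ℝ) (W : Set (ℝ × ℝ)) (κ lam : ℝ × ℝ → ℝ),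
      IsOpen W ∧ (0 : ℝ × ℝ) ∈ W ∧ φ 0 = 0 ∧
      ContDiffOn ℝ (⊤ : ℕ∞) φ W ∧ (∀ p ∈ W, (fderiv ℝ φ p).det ≠ 0) ∧
      ContDiffOn ℝ (⊤ : ℕ∞) κ W ∧ (∀ p ∈ W, κ p ≠ 0) ∧
      ContDiffOn ℝ (⊤ : ℕ∞) lam W ∧ (∀ p ∈ W, lam p ≠ 0) ∧
      -- a = κ·φ*(a)
      (∀ p ∈ W, a p = κ p • ((a (φ p)).comp (fderiv ℝ φ p))) ∧
      -- f = λ·((j^k f) ∘ φ)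
      (∀ p ∈ W, f p = lam p * jet k f (φ p)) := by
  have hU : U ∈ nhds (0 : ℝ × ℝ) := hUo.mem_nhds hU0
  have hXa' : ∀ p, Xa p = (a p (0, 1), -a p (1, 0)) := fun p => eq_of_omegaForm (hXa p)
  have hXa0 : Xa 0 = 0 := by rw [hXa', ha0]; simp
  obtain _ | k := k
  · obtain ⟨c, W, -, hW0, u, v, -, -, h⟩ := hdiv (fun _ => 1) U hUo hU0 contDiffOn_const
    have := h 0 hW0
    rw [hf0, hLf, hXa0] at this
    simp at this
  obtain ⟨X₁, hX₁⟩ := SmoothFun.exists_eventuallyEq hU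
    (ha.clm_apply (contDiffOn_const (c := ((0 : ℝ), (1 : ℝ)))))
  obtain ⟨X₂, hX₂⟩ := SmoothFun.exists_eventuallyEq hU
    (ha.clm_apply (contDiffOn_const (c := ((1 : ℝ), (0 : ℝ))))).neg
  obtain ⟨P, hP⟩ := SmoothFun.exists_eventuallyEq hU hf
  choose c hc using fun i => SmoothFun.exists_eventuallyEq hU (he i)
  have hX : ∀ᶠ p in nhds 0, (X₁.1 p, X₂.1 p) = Xa p := by
    filter_upwards [hX₁, hX₂] with p h₁ h₂
    rw [h₁, h₂, hXa']
  have hX0 := hX.self_of_nhds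
  rw [hXa0] at hX0
  have hQ : (SmoothFun.lieDeriv X₁ X₂ P).1 =ᶠ[nhds 0] Lf := by
    filter_upwards [hX, hP.fderiv (𝕜 := ℝ)] with p hp hd
    rw [SmoothFun.lieDeriv_apply, hp, hd, hLf]
  have hpow := SmoothFun.pow_le_germIdeal (P := P) (Q := SmoothFun.lieDeriv X₁ X₂ P) c fun F => by
    obtain ⟨b, W, hWo, hW0, u, v, hu, hv, h⟩ :=
      hdiv F.1 Set.univ isOpen_univ trivial (SmoothFun.contDiff F).contDiffOn
    have hW := hWo.mem_nhds hW0
    obtain ⟨u', hu'⟩ := SmoothFun.exists_eventuallyEq hW hu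
    obtain ⟨v', hv'⟩ := SmoothFun.exists_eventuallyEq hW hv
    refine ⟨b, SmoothFun.mem_germIdeal.2 ⟨u', v', ?_⟩⟩
    filter_upwards [hW, hu', hv', hP, hQ, Filter.eventually_all.2 hc] with p hpW hup hvp hPp hQp hcp
    have hsum : (∑ i, b i • c i).1 p = ∑ i, b i * e i p := by
      have hval := congrFun (map_sum SmoothFun.val (fun i => b i • c i) Finset.univ) p
      rw [Finset.sum_apply] at hval
      refine hval.trans (Finset.sum_congr rfl fun i _ => ?_)
      rw [← hcp i]
      rfl
    change F.1 p - (∑ i, b i • c i).1 p = u'.1 p * P.1 p + v'.1 p * _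
    rw [h p hpW, hsum, hup, hvp, hPp, hQp]
    ring
  obtain ⟨φ, W, κ, lam, hW, h0, hφ0, hφ, hdet, hκ, hκ0, hlam, hlam0, hω, hPφ⟩ :=
    SmoothFun.exists_conjugation_jet (congrArg Prod.fst hX0) (congrArg Prod.snd hX0) hpow
  have hφc : Filter.Tendsto φ (nhds 0) (nhds 0) := by
    simpa only [ContinuousAt, hφ0] using hφ.continuousOn.continuousAt (hW.mem_nhds h0)
  obtain ⟨V, hV, hVo, hV0⟩ := eventually_nhds_iff.1
    (((hX.and (hφc.eventually hX)).and hP).and (hW.mem_nhds h0))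
  have hVW : V ⊆ W := fun p hp => (hV p hp).2
  refine ⟨φ, V, κ, lam, hVo, hV0, hφ0, hφ.mono hVW, fun p hp => hdet p (hVW hp), hκ.mono hVW,
    fun p hp => hκ0 p (hVW hp), hlam.mono hVW, fun p hp => hlam0 p (hVW hp), fun p hp => ?_,
    fun p hp => ?_⟩
  · refine ContinuousLinearMap.ext fun w => ?_
    have h := hω p (hVW hp) w
    rw [(hV p hp).1.1.1, (hV p hp).1.1.2, hXa, hXa] at h
    exact h
  · have h := hPφ p (hVW hp)
    rwa [(hV p hp).1.2, jet_congr hP] at h
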